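/- Let Ψ be an axisymmetric C² function. The scalar second-order operator L(Ψ) := −(1/ρ₀)(ΔΨ − Ψ/(r²sin²θ)) + (∂_rρ₀/(ρ₀²r))∂_r(rΨ) − (u₀²/(ρ₀(c₀²−u₀²)r²))((1/sinθ)∂_θ(sinθ∂_θΨ) − Ψ/sin²θ) equals the e_φ-component of −Div(A D(Ψe_φ)) + (∂_rρ₀/(ρ₀²r))Ψe_φ, where A = (c₀²/(ρ₀(c₀²−u₀²)))(I − (u₀²/c₀²)P_r) with P_r as the tensor (I⊗e_r⊗e_r⊗I) acting by (a⊗b) ↦ (b·e_r)a⊗e_r; i.e., the singular curl-curl equation for Ψ is equivalent to an elliptic system for the vector field Ψe_φ. -/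

import Mathlib

/-- The `i`-th partial derivative of a scalar function on `ℝ³`. -/
noncomputable def pd (i : Fin 3) (f : (Fin 3 → ℝ) → ℝ) (p : Fin 3 → ℝ) : ℝ :=
  fderiv ℝ f p (Pi.single i 1)

/-- The spherical radius `r`. -/
noncomputable def rad (p : Fin 3 → ℝ) : ℝ := Real.sqrt ((p 0)^2 + (p 1)^2 + (p 2)^2)

/-- The polar angle `θ`. -/
noncomputable def pol (p : Fin 3 → ℝ) : ℝ := Real.arccos (p 2 / rad p)

/-- The radial unit vector `e_r`. -/
noncomputable def er (p : Fin 3 → ℝ) : Fin 3 → ℝ := fun i => p i / rad p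

/-- The azimuthal unit vector `e_φ`. -/
noncomputable def ephi (p : Fin 3 → ℝ) : Fin 3 → ℝ :=
  ![-(p 1) / Real.sqrt ((p 0)^2 + (p 1)^2), p 0 / Real.sqrt ((p 0)^2 + (p 1)^2), 0]

/-- The Jacobian matrix `(DF)_{ij} = ∂_j F_i` of a vector field. -/
noncomputable def jac (F : (Fin 3 → ℝ) → (Fin 3 → ℝ)) (p : Fin 3 → ℝ) :
    Fin 3 → Fin 3 → ℝ :=
  fun i j => pd j (fun q => F q i) p

/-- The row-wise divergence `(Div G)_i = Σ_j ∂_j G_{ij}` of a matrix field. -/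
noncomputable def divT (G : (Fin 3 → ℝ) → Fin 3 → Fin 3 → ℝ) (p : Fin 3 → ℝ) :
    Fin 3 → ℝ :=
  fun i => ∑ j, pd j (fun q => G q i j) p

/-- The coefficient tensor `A(M) = α M − β (M e) ⊗ e`, i.e.
`A = α(I − (β/α)(I⊗e⊗e⊗I))` acting on `3×3` matrices. -/
noncomputable def Atensor (α β : ℝ) (e : Fin 3 → ℝ) (M : Fin 3 → Fin 3 → ℝ) :
    Fin 3 → Fin 3 → ℝ :=
  fun i j => α * M i j - β * (∑ k, M i k * e k) * e j

/-- The scalar spherical Laplacian of an axisymmetric function `Ψ(r, θ)`. -/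
noncomputable def sphLap (Ψ : ℝ × ℝ → ℝ) (r θ : ℝ) : ℝ :=
  (1/r^2) * deriv (fun s => s^2 * deriv (fun a => Ψ (a, θ)) s) r
    + (1/(r^2 * Real.sin θ)) * deriv (fun t => Real.sin t * deriv (fun a => Ψ (r, a)) t) θ


/-- `f` is differentiable at `p` with `j`-th partial derivative `v`. -/
def HasPd (j : Fin 3) (f : (Fin 3 → ℝ) → ℝ) (p : Fin 3 → ℝ) (v : ℝ) : Prop :=
  ∃ f' : (Fin 3 → ℝ) →L[ℝ] ℝ, HasFDerivAt f f' p ∧ f' (Pi.single j 1) = v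

namespace HasPd
variable {j : Fin 3} {f g : (Fin 3 → ℝ) → ℝ} {p : Fin 3 → ℝ} {a b : ℝ}

theorem pd_eq (h : HasPd j f p a) : pd j f p = a := by
  obtain ⟨f', hf, rfl⟩ := h
  simp [pd, hf.fderiv]

theorem congr_val (h : HasPd j f p a) (e : a = b) : HasPd j f p b := e ▸ h

theorem congr_fun (h : HasPd j f p a) (e : g =ᶠ[nhds p] f) : HasPd j g p a := by
  obtain ⟨f', hf, h2⟩ := h
  exact ⟨f', hf.congr_of_eventuallyEq e, h2⟩

theorem add (hf : HasPd j f p a) (hg : HasPd j g p b) :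
    HasPd j (fun q => f q + g q) p (a + b) := by
  obtain ⟨f', hf, rfl⟩ := hf
  obtain ⟨g', hg, rfl⟩ := hg
  exact ⟨_, hf.add hg, by simp⟩

theorem mul (hf : HasPd j f p a) (hg : HasPd j g p b) :
    HasPd j (fun q => f q * g q) p (a * g p + f p * b) := by
  obtain ⟨f', hf, rfl⟩ := hf
  obtain ⟨g', hg, rfl⟩ := hg
  exact ⟨_, hf.mul hg, by simp; ring⟩

theorem const (c : ℝ) : HasPd j (fun _ => c) p 0 := ⟨_, hasFDerivAt_const c p, by simp⟩

theorem coord (i : Fin 3) : HasPd j (fun q => q i) p ((Pi.single j 1 : Fin 3 → ℝ) i) :=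
  ⟨_, (ContinuousLinearMap.proj (R := ℝ) (φ := fun _ : Fin 3 => ℝ) i).hasFDerivAt, by simp⟩

theorem comp {h : ℝ → ℝ} {h' : ℝ} (hh : HasDerivAt h h' (f p)) (hf : HasPd j f p a) :
    HasPd j (fun q => h (f q)) p (h' * a) := by
  obtain ⟨f', hf, rfl⟩ := hf
  exact ⟨_, hh.comp_hasFDerivAt p hf, by simp⟩

theorem comp2 {h : ℝ × ℝ → ℝ} (hh : DifferentiableAt ℝ h (f p, g p))
    (hf : HasPd j f p a) (hg : HasPd j g p b) :
    HasPd j (fun q => h (f q, g q)) p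
      (fderiv ℝ h (f p, g p) (1, 0) * a + fderiv ℝ h (f p, g p) (0, 1) * b) := by
  obtain ⟨f', hf, rfl⟩ := hf
  obtain ⟨g', hg, rfl⟩ := hg
  refine ⟨_, HasFDerivAt.comp p (f := fun q => (f q, g q)) hh.hasFDerivAt (hf.prodMk hg), ?_⟩
  have : ∀ u v : ℝ, ((u, v) : ℝ × ℝ) = u • ((1 : ℝ), (0 : ℝ)) + v • ((0 : ℝ), (1 : ℝ)) := by
    intro u v; simp
  simp only [ContinuousLinearMap.comp_apply, ContinuousLinearMap.prod_apply]
  rw [this (f' _) (g' _), map_add, map_smul, map_smul]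
  simp only [smul_eq_mul]
  ring

theorem div (hf : HasPd j f p a) (hg : HasPd j g p b) (h0 : g p ≠ 0) :
    HasPd j (fun q => f q / g q) p ((a * g p - f p * b) / (g p) ^ 2) := by
  have h := hf.mul (comp (hasDerivAt_inv h0) hg)
  simp only [← div_eq_mul_inv] at h
  refine h.congr_val ?_
  field_simp
  ring

theorem glue {F : (Fin 3 → ℝ) → Fin 3 → ℝ} {c v : ℝ} (h0 : HasPd 0 (fun q => F q 0) p a)
    (h1 : HasPd 1 (fun q => F q 1) p b) (h2 : HasPd 2 (fun q => F q 2) p c)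
    (e : a + b + c = v) :
    ∃ d : Fin 3 → ℝ, (∀ j, HasPd j (fun q => F q j) p (d j)) ∧ d 0 + d 1 + d 2 = v := by
  refine ⟨![a, b, c], fun j => ?_, by simpa using e⟩
  fin_cases j
  · exact h0
  · exact h1
  · exact h2

end HasPd

/-- Cylindrical radius. -/
noncomputable def cyl (p : Fin 3 → ℝ) : ℝ := Real.sqrt ((p 0)^2 + (p 1)^2)

/-- Gradient of the polar angle. -/
noncomputable def gT (p : Fin 3 → ℝ) : Fin 3 → ℝ :=
  ![p 0 * p 2 / (rad p * rad p * cyl p), p 1 * p 2 / (rad p * rad p * cyl p),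
    (-1) * cyl p / (rad p * rad p)]

/-- Jacobian of `ephi`. -/
noncomputable def gE (p : Fin 3 → ℝ) : Fin 3 → Fin 3 → ℝ :=
  ![![p 0 * p 1 / (cyl p * cyl p * cyl p), (-1) * (p 0 * p 0) / (cyl p * cyl p * cyl p), 0],
    ![p 1 * p 1 / (cyl p * cyl p * cyl p), (-1) * (p 0 * p 1) / (cyl p * cyl p * cyl p), 0],
    ![0, 0, 0]]


theorem cyl_pos {p : Fin 3 → ℝ} (hp : (p 0)^2 + (p 1)^2 ≠ 0) : 0 < cyl p := Real.sqrt_pos.2 (lt_of_le_of_ne (by positivity) hp.symm)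

theorem rad_pos {p : Fin 3 → ℝ} (hp : (p 0)^2 + (p 1)^2 ≠ 0) : 0 < rad p := by
  have : 0 < (p 0)^2 + (p 1)^2 := lt_of_le_of_ne (by positivity) hp.symm
  exact Real.sqrt_pos.2 (by positivity)

theorem cyl_sq {p : Fin 3 → ℝ} : cyl p ^ 2 = (p 0)^2 + (p 1)^2 := Real.sq_sqrt (by positivity)

theorem rad_sq {p : Fin 3 → ℝ} : rad p ^ 2 = (p 0)^2 + (p 1)^2 + (p 2)^2 := Real.sq_sqrt (by positivity)

theorem hasPd_cyl {p : Fin 3 → ℝ} (hp : (p 0)^2 + (p 1)^2 ≠ 0) (j : Fin 3) : HasPd j cyl p (![p 0 / cyl p, p 1 / cyl p, 0] j) := by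
  have h := HasPd.comp (j := j) (p := p) (f := fun q => q 0 * q 0 + q 1 * q 1)
    (Real.hasDerivAt_sqrt (by simpa [sq] using hp))
    (((HasPd.coord 0).mul (HasPd.coord 0)).add ((HasPd.coord 1).mul (HasPd.coord 1)))
  have e : (fun q : Fin 3 → ℝ => Real.sqrt (q 0 * q 0 + q 1 * q 1)) = cyl := by
    funext q; simp [cyl, sq]
  have e' : Real.sqrt (p 0 * p 0 + p 1 * p 1) = cyl p := congrFun e p
  rw [e] at h
  refine h.congr_val ?_
  have := cyl_pos hp
  rw [e']
  fin_cases j <;> simp <;> field_simp <;> ring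

theorem hasPd_rad {p : Fin 3 → ℝ} (hp : (p 0)^2 + (p 1)^2 ≠ 0) (j : Fin 3) : HasPd j rad p (p j / rad p) := by
  have h := HasPd.comp (j := j) (p := p) (f := fun q => q 0 * q 0 + q 1 * q 1 + q 2 * q 2)
    (Real.hasDerivAt_sqrt (by
      have : 0 < (p 0)^2 + (p 1)^2 := lt_of_le_of_ne (by positivity) hp.symm
      nlinarith [sq_nonneg (p 2)]))
    ((((HasPd.coord 0).mul (HasPd.coord 0)).add ((HasPd.coord 1).mul (HasPd.coord 1))).add
      ((HasPd.coord 2).mul (HasPd.coord 2)))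
  have e : (fun q : Fin 3 → ℝ => Real.sqrt (q 0 * q 0 + q 1 * q 1 + q 2 * q 2)) = rad := by
    funext q; simp [rad, sq]
  have e' : Real.sqrt (p 0 * p 0 + p 1 * p 1 + p 2 * p 2) = rad p := congrFun e p
  rw [e] at h
  refine h.congr_val ?_
  have := rad_pos hp
  rw [e']
  fin_cases j <;> simp <;> field_simp <;> ring

theorem sqrt_aux {p : Fin 3 → ℝ} (hp : (p 0)^2 + (p 1)^2 ≠ 0) : Real.sqrt (1 - (p 2 / rad p) ^ 2) = cyl p / rad p := by
  have hr := rad_pos hp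
  have hs := cyl_pos hp
  rw [Real.sqrt_eq_iff_mul_self_eq_of_pos (by positivity)]
  have h1 := cyl_sq (p := p)
  have h2 := rad_sq (p := p)
  field_simp
  linarith

theorem hasPd_pol {p : Fin 3 → ℝ} (hp : (p 0)^2 + (p 1)^2 ≠ 0) (j : Fin 3) : HasPd j pol p (gT p j) := by
  have hr := rad_pos hp
  have hs := cyl_pos hp
  have h1 := cyl_sq (p := p)
  have h2 := rad_sq (p := p)
  have hlt : (p 2 / rad p) ^ 2 < 1 := by
    rw [div_pow, div_lt_one (by positivity)]
    nlinarith
  have hab := abs_lt.1 ((sq_lt_one_iff_abs_lt_one _).1 hlt)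
  have h := HasPd.comp (j := j) (p := p) (f := fun q => q 2 / rad q)
    (Real.hasDerivAt_arccos hab.1.ne' hab.2.ne)
    ((HasPd.coord 2).div (hasPd_rad hp j) hr.ne')
  refine HasPd.congr_val h ?_
  rw [sqrt_aux hp]
  fin_cases j <;> simp [gT] <;> field_simp
  linarith

theorem hasPd_ephi {p : Fin 3 → ℝ} (hp : (p 0)^2 + (p 1)^2 ≠ 0) (i j : Fin 3) : HasPd j (fun q => ephi q i) p (gE p i j) := by
  have hs := cyl_pos hp
  have h1 := cyl_sq (p := p)
  fin_cases i
  · have h := ((HasPd.const (j := j) (p := p) (-1)).mul (HasPd.coord 1)).div (hasPd_cyl hp j) hs.ne'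
    have e : (fun q => ephi q 0) = fun q => (-1) * q 1 / cyl q := by
      funext q; simp [ephi, cyl]
    change HasPd j (fun q => ephi q 0) p _
    rw [e]
    refine h.congr_val ?_
    fin_cases j <;> simp [gE] <;> field_simp
    linarith
  · have h := (HasPd.coord (j := j) (p := p) 0).div (hasPd_cyl hp j) hs.ne'
    have e : (fun q => ephi q 1) = fun q => q 0 / cyl q := by
      funext q; simp [ephi, cyl]
    change HasPd j (fun q => ephi q 1) p _
    rw [e]
    refine h.congr_val ?_
    fin_cases j <;> simp [gE] <;> field_simp
    linarith
  · have e : (fun q => ephi q 2) = fun q => 0 := by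
      funext q; simp [ephi]
    change HasPd j (fun q => ephi q 2) p _
    rw [e]
    refine (HasPd.const 0).congr_val ?_
    fin_cases j <;> simp [gE]

theorem hasPd_gT {p : Fin 3 → ℝ} (hp : (p 0)^2 + (p 1)^2 ≠ 0) : ∃ d : Fin 3 → ℝ, (∀ j, HasPd j (fun q => gT q j) p (d j)) ∧
    d 0 + d 1 + d 2 = p 2 / (cyl p * rad p ^ 2) := by
  have hr := rad_pos hp
  have hs := cyl_pos hp
  have h1 := cyl_sq (p := p)
  have h2 := rad_sq (p := p)
  have a0 := ((HasPd.coord (j := 0) (p := p) 0).mul (HasPd.coord 2)).div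
    (((hasPd_rad hp 0).mul (hasPd_rad hp 0)).mul (hasPd_cyl hp 0)) (by positivity)
  have a1 := ((HasPd.coord (j := 1) (p := p) 1).mul (HasPd.coord 2)).div
    (((hasPd_rad hp 1).mul (hasPd_rad hp 1)).mul (hasPd_cyl hp 1)) (by positivity)
  have a2 := ((HasPd.const (j := 2) (p := p) (-1)).mul (hasPd_cyl hp 2)).div
    ((hasPd_rad hp 2).mul (hasPd_rad hp 2)) (by positivity)
  refine HasPd.glue a0 a1 a2 ?_
  simp
  field_simp
  linear_combination p 2 * (2 * cyl p ^ 2 + rad p ^ 2) * h1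

theorem hasPd_gE {p : Fin 3 → ℝ} (hp : (p 0)^2 + (p 1)^2 ≠ 0) (i : Fin 3) : ∃ d : Fin 3 → ℝ, (∀ j, HasPd j (fun q => gE q i j) p (d j)) ∧
    d 0 + d 1 + d 2 = - ephi p i / cyl p ^ 2 := by
  have hs := cyl_pos hp
  have h1 := cyl_sq (p := p)
  have hc := fun j => ((hasPd_cyl hp j).mul (hasPd_cyl hp j)).mul (hasPd_cyl hp j)
  have x (j i) := HasPd.coord (j := j) (p := p) i
  have e : Real.sqrt (p 0 ^ 2 + p 1 ^ 2) = cyl p := rfl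
  fin_cases i
  · have a0 := ((x 0 0).mul (x 0 1)).div (hc 0) (by positivity)
    have a1 := ((HasPd.const (-1)).mul ((x 1 0).mul (x 1 0))).div (hc 1) (by positivity)
    refine HasPd.glue a0 a1 (HasPd.const 0) ?_
    simp [ephi, e]
    field_simp
    ring
  · have a0 := ((x 0 1).mul (x 0 1)).div (hc 0) (by positivity)
    have a1 := ((HasPd.const (-1)).mul ((x 1 0).mul (x 1 1))).div (hc 1) (by positivity)
    refine HasPd.glue a0 a1 (HasPd.const 0) ?_
    simp [ephi, e]
    field_simp
    ring
  · refine ⟨0, fun j => ?_, by simp [ephi]⟩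
    fin_cases j <;> exact HasPd.const 0

theorem gT_er {p : Fin 3 → ℝ} (hp : (p 0)^2 + (p 1)^2 ≠ 0) : gT p 0 * p 0 + gT p 1 * p 1 + gT p 2 * p 2 = 0 := by
  have hr := rad_pos hp
  have hs := cyl_pos hp
  have h1 := cyl_sq (p := p)
  simp [gT]
  field_simp
  rw [h1]; ring

theorem gT_gT {p : Fin 3 → ℝ} (hp : (p 0)^2 + (p 1)^2 ≠ 0) : gT p 0 ^ 2 + gT p 1 ^ 2 + gT p 2 ^ 2 = 1 / rad p ^ 2 := by
  have hr := rad_pos hp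
  have hs := cyl_pos hp
  have h1 := cyl_sq (p := p)
  have h2 := rad_sq (p := p)
  simp [gT]
  field_simp
  rw [h2]
  linear_combination (cyl p ^ 2 - p 2 ^ 2) * h1

theorem gE_er {p : Fin 3 → ℝ} (hp : (p 0)^2 + (p 1)^2 ≠ 0) (i : Fin 3) : gE p i 0 * p 0 + gE p i 1 * p 1 + gE p i 2 * p 2 = 0 := by
  have hs := cyl_pos hp
  fin_cases i <;> simp [gE] <;> field_simp <;> ring

theorem gE_gT {p : Fin 3 → ℝ} (hp : (p 0)^2 + (p 1)^2 ≠ 0) (i : Fin 3) : gE p i 0 * gT p 0 + gE p i 1 * gT p 1 + gE p i 2 * gT p 2 = 0 := by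
  have hr := rad_pos hp
  have hs := cyl_pos hp
  fin_cases i <;> simp [gE, gT] <;> field_simp <;> ring


/-- The singular scalar operator
`L(Ψ) = −(1/ρ₀)(ΔΨ − Ψ/(r²sin²θ)) + (∂_rρ₀/(ρ₀²r))∂_r(rΨ)
  − (u₀²/(ρ₀(c₀²−u₀²)r²))((1/sinθ)∂_θ(sinθ∂_θΨ) − Ψ/sin²θ)`
equals the `e_φ`-component of `−Div(A D(Ψe_φ)) + (∂_rρ₀/(ρ₀²r))Ψe_φ`, where
`A = (c₀²/(ρ₀(c₀²−u₀²)))(I − (u₀²/c₀²)(I⊗e_r⊗e_r⊗I))`: the singular curl–curl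
equation for `Ψ` is equivalent to an elliptic system for the vector field `Ψe_φ`. -/
theorem stmt_16 (ρ₀ u₀ c₀ : ℝ → ℝ)
    (hρ : ContDiff ℝ (⊤ : ℕ∞) ρ₀) (hu : ContDiff ℝ (⊤ : ℕ∞) u₀) (hc : ContDiff ℝ (⊤ : ℕ∞) c₀)
    (hpos : ∀ r : ℝ, 0 < r → 0 < ρ₀ r ∧ 0 < c₀ r ∧ 0 ≤ u₀ r ∧ u₀ r < c₀ r)
    (Ψ : ℝ × ℝ → ℝ) (hΨ : ContDiff ℝ 2 Ψ)
    (p : Fin 3 → ℝ) (hp : (p 0)^2 + (p 1)^2 ≠ 0) :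
    ∑ i, (- divT (fun q => Atensor
              ((c₀ (rad q))^2 / (ρ₀ (rad q) * ((c₀ (rad q))^2 - (u₀ (rad q))^2)))
              ((u₀ (rad q))^2 / (ρ₀ (rad q) * ((c₀ (rad q))^2 - (u₀ (rad q))^2)))
              (er q)
              (jac (fun q' => Ψ (rad q', pol q') • ephi q') q)) p i
            + (deriv ρ₀ (rad p) / ((ρ₀ (rad p))^2 * rad p))
                * (Ψ (rad p, pol p) • ephi p) i)
          * ephi p i
      = - (1 / ρ₀ (rad p)) * (sphLap Ψ (rad p) (pol p)
            - Ψ (rad p, pol p) / ((rad p)^2 * (Real.sin (pol p))^2))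
        + (deriv ρ₀ (rad p) / ((ρ₀ (rad p))^2 * rad p))
            * deriv (fun s => s * Ψ (s, pol p)) (rad p)
        - ((u₀ (rad p))^2 / (ρ₀ (rad p) * ((c₀ (rad p))^2 - (u₀ (rad p))^2) * (rad p)^2))
            * ((1 / Real.sin (pol p))
                * deriv (fun t => Real.sin t * deriv (fun a => Ψ (rad p, a)) t) (pol p)
              - Ψ (rad p, pol p) / (Real.sin (pol p))^2) := by
  
  have hr := rad_pos hp
  have hs := cyl_pos hp
  have h1 := cyl_sq (p := p)
  have h2 := rad_sq (p := p)
  obtain ⟨hρp, hcp, hup, huc⟩ := hpos _ hr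
  have hD : 0 < c₀ (rad p) ^ 2 - u₀ (rad p) ^ 2 := by nlinarith
  have hΨd : Differentiable ℝ Ψ := hΨ.differentiable (by norm_num)
  have hfd : ContDiff ℝ 1 (fderiv ℝ Ψ) := hΨ.fderiv_right (by norm_num)
  obtain ⟨P1, hP1⟩ : ∃ P1 : ℝ × ℝ → ℝ, P1 = fun x => fderiv ℝ Ψ x (1, 0) := ⟨_, rfl⟩
  obtain ⟨P2, hP2⟩ : ∃ P2 : ℝ × ℝ → ℝ, P2 = fun x => fderiv ℝ Ψ x (0, 1) := ⟨_, rfl⟩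
  have hP1d : Differentiable ℝ P1 := by
    rw [hP1]; exact (hfd.clm_apply contDiff_const).differentiable (by norm_num)
  have hP2d : Differentiable ℝ P2 := by
    rw [hP2]; exact (hfd.clm_apply contDiff_const).differentiable (by norm_num)
  have line1 : ∀ (h : ℝ × ℝ → ℝ), Differentiable ℝ h → ∀ s t,
      HasDerivAt (fun a => h (a, t)) (fderiv ℝ h (s, t) (1, 0)) s := by
    intro h hh s t
    exact HasFDerivAt.comp_hasDerivAt (f := fun a : ℝ => (a, t)) s (hh (s, t)).hasFDerivAt
      ((hasDerivAt_id s).prodMk (hasDerivAt_const s t))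
  have line2 : ∀ (h : ℝ × ℝ → ℝ), Differentiable ℝ h → ∀ s t,
      HasDerivAt (fun a => h (s, a)) (fderiv ℝ h (s, t) (0, 1)) t := by
    intro h hh s t
    exact HasFDerivAt.comp_hasDerivAt (f := fun a : ℝ => (s, a)) t (hh (s, t)).hasFDerivAt
      ((hasDerivAt_const t s).prodMk (hasDerivAt_id t))
  have d1 : ∀ s t, deriv (fun a => Ψ (a, t)) s = P1 (s, t) := fun s t => by
    rw [(line1 Ψ hΨd s t).deriv, hP1]
  have d2 : ∀ s t, deriv (fun a => Ψ (s, a)) t = P2 (s, t) := fun s t => by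
    rw [(line2 Ψ hΨd s t).deriv, hP2]
  obtain ⟨A, hA⟩ : ∃ A : ℝ → ℝ, A = fun s =>
    (c₀ s)^2 / (ρ₀ s * ((c₀ s)^2 - (u₀ s)^2)) := ⟨_, rfl⟩
  have hρd : Differentiable ℝ ρ₀ := hρ.differentiable (by simp)
  have hud : Differentiable ℝ u₀ := hu.differentiable (by simp)
  have hcd : Differentiable ℝ c₀ := hc.differentiable (by simp)
  have hAd : DifferentiableAt ℝ A (rad p) := by
    rw [hA]
    exact ((hcd _).pow 2).div ((hρd _).mul (((hcd _).pow 2).sub ((hud _).pow 2)))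
      (mul_pos hρp hD).ne'
  obtain ⟨A', hA'⟩ : ∃ A', HasDerivAt A A' (rad p) := ⟨_, hAd.hasDerivAt⟩
  have hR : HasDerivAt (fun s => (ρ₀ s)⁻¹) (- deriv ρ₀ (rad p) / ρ₀ (rad p) ^ 2) (rad p) :=
    (hρd _).hasDerivAt.inv hρp.ne'
  have flux : ∀ q : Fin 3 → ℝ, (q 0)^2 + (q 1)^2 ≠ 0 → ∀ i j,
      Atensor ((c₀ (rad q))^2 / (ρ₀ (rad q) * ((c₀ (rad q))^2 - (u₀ (rad q))^2)))
              ((u₀ (rad q))^2 / (ρ₀ (rad q) * ((c₀ (rad q))^2 - (u₀ (rad q))^2)))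
              (er q)
              (jac (fun q' => Ψ (rad q', pol q') • ephi q') q) i j
      = A (rad q) * (P2 (rad q, pol q) * (gT q j * ephi q i) + Ψ (rad q, pol q) * gE q i j)
        + (ρ₀ (rad q))⁻¹ * (P1 (rad q, pol q) * (ephi q i * (q j / rad q))) := by
    intro q hq i j
    have hrq := rad_pos hq
    obtain ⟨hρq, hcq, huq, hucq⟩ := hpos _ hrq
    have hDq : 0 < c₀ (rad q) ^ 2 - u₀ (rad q) ^ 2 := by nlinarith
    have hj : ∀ j, jac (fun q' => Ψ (rad q', pol q') • ephi q') q i j =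
        (P1 (rad q, pol q) * (q j / rad q) + P2 (rad q, pol q) * gT q j) * ephi q i
          + Ψ (rad q, pol q) * gE q i j := by
      intro j
      have h := (HasPd.comp2 (hΨd _) (hasPd_rad hq j) (hasPd_pol hq j)).mul (hasPd_ephi hq i j)
      rw [hP1, hP2]
      exact h.pd_eq
    have hsum : (∑ k, jac (fun q' => Ψ (rad q', pol q') • ephi q') q i k * er q k)
        = P1 (rad q, pol q) * ephi q i := by
      have t1 := gT_er hq
      have t2 := gE_er hq i
      have t3 := rad_sq (p := q)
      simp only [hj, er, Fin.sum_univ_three]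
      field_simp
      linear_combination (-P1 (rad q, pol q) * ephi q i) * t3
        + (rad q * P2 (rad q, pol q) * ephi q i) * t1 + rad q * Ψ (rad q, pol q) * t2
    have hdiff : (ρ₀ (rad q))⁻¹ = A (rad q) -
        (u₀ (rad q))^2 / (ρ₀ (rad q) * ((c₀ (rad q))^2 - (u₀ (rad q))^2)) := by
      rw [hA]; field_simp
    have hAq : (c₀ (rad q))^2 / (ρ₀ (rad q) * ((c₀ (rad q))^2 - (u₀ (rad q))^2)) = A (rad q) := by
      rw [hA]
    simp only [Atensor]
    rw [hsum, hj, hdiff, hAq]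
    simp only [er]
    ring
  obtain ⟨K, hK⟩ : ∃ K, K = A (rad p) * (fderiv ℝ P2 (rad p, pol p) (0, 1) / rad p ^ 2
      + P2 (rad p, pol p) * (p 2 / (cyl p * rad p ^ 2)) - Ψ (rad p, pol p) / cyl p ^ 2)
      + (- deriv ρ₀ (rad p) / ρ₀ (rad p) ^ 2) * P1 (rad p, pol p)
      + (ρ₀ (rad p))⁻¹ * (fderiv ℝ P1 (rad p, pol p) (1, 0) + 2 * P1 (rad p, pol p) / rad p) :=
    ⟨_, rfl⟩
  have hev : ∀ᶠ q : Fin 3 → ℝ in nhds p, (q 0)^2 + (q 1)^2 ≠ 0 := by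
    have : Continuous fun q : Fin 3 → ℝ => (q 0)^2 + (q 1)^2 := by fun_prop
    exact this.continuousAt.eventually_ne hp
  have hdiv : ∀ i, divT (fun q => Atensor
              ((c₀ (rad q))^2 / (ρ₀ (rad q) * ((c₀ (rad q))^2 - (u₀ (rad q))^2)))
              ((u₀ (rad q))^2 / (ρ₀ (rad q) * ((c₀ (rad q))^2 - (u₀ (rad q))^2)))
              (er q)
              (jac (fun q' => Ψ (rad q', pol q') • ephi q') q)) p i = ephi p i * K := by
    intro i
    obtain ⟨dT, hdT, sT⟩ := hasPd_gT hp
    obtain ⟨dE, hdE, sE⟩ := hasPd_gE hp i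
    have hpdj : ∀ j, _ := fun j =>
      (((HasPd.comp hA' (hasPd_rad hp j)).mul
        (((HasPd.comp2 (hP2d _) (hasPd_rad hp j) (hasPd_pol hp j)).mul
            ((hdT j).mul (hasPd_ephi hp i j))).add
          ((HasPd.comp2 (hΨd _) (hasPd_rad hp j) (hasPd_pol hp j)).mul (hdE j)))).add
        ((HasPd.comp hR (hasPd_rad hp j)).mul
          ((HasPd.comp2 (hP1d _) (hasPd_rad hp j) (hasPd_pol hp j)).mul
            ((hasPd_ephi hp i j).mul
              ((HasPd.coord j).div (hasPd_rad hp j) hr.ne'))))).congr_fun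
        (hev.mono fun q hq => flux q hq i j) |>.pd_eq
    simp only [divT, Fin.sum_univ_three, hpdj]
    have t1 := gT_er hp
    have t2 := gE_er hp i
    have t3 := gE_gT hp i
    have t4 := gT_gT hp
    have c1 : fderiv ℝ Ψ (rad p, pol p) (1, 0) = P1 (rad p, pol p) := by rw [hP1]
    have c2 : fderiv ℝ Ψ (rad p, pol p) (0, 1) = P2 (rad p, pol p) := by rw [hP2]
    rw [hK, c1, c2]
    clear hpdj hev flux hK
    simp only [Pi.single_eq_same]
    generalize fderiv ℝ P2 (rad p, pol p) (0, 1) = P22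
    generalize fderiv ℝ P2 (rad p, pol p) (1, 0) = P21
    generalize fderiv ℝ P1 (rad p, pol p) (0, 1) = P12
    generalize fderiv ℝ P1 (rad p, pol p) (1, 0) = P11
    generalize P1 (rad p, pol p) = Q1
    generalize P2 (rad p, pol p) = Q2
    generalize Ψ (rad p, pol p) = Q
    generalize A (rad p) = a
    generalize (ρ₀ (rad p))⁻¹ = b
    generalize - deriv ρ₀ (rad p) / ρ₀ (rad p) ^ 2 = b'
    generalize ephi p i = e at *
    generalize rad p = r at *
    have hn : (p 0 * p 0 + p 1 * p 1 + p 2 * p 2) * (r⁻¹) ^ 2 = 1 := by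
      field_simp; linarith
    have hri : r * r⁻¹ = 1 := mul_inv_cancel₀ hr.ne'
    linear_combination A' * r⁻¹ * (Q2 * e * t1 + Q * t2)
      + a * (P21 * r⁻¹ * e * t1 + P22 * e * t4 + Q2 * e * sT + 2 * Q2 * t3 + Q1 * r⁻¹ * t2 + Q * sE)
      + b' * Q1 * e * hn
      + b * (P11 * e * hn + P12 * r⁻¹ * e * t1 + Q1 * r⁻¹ * t2
        + Q1 * e * (3 * r⁻¹ * hri - r⁻¹ * hn))
  have hee : ∑ i, ephi p i * ephi p i = 1 := by
    have e : Real.sqrt (p 0 ^ 2 + p 1 ^ 2) = cyl p := rfl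
    simp [Fin.sum_univ_three, ephi, e]
    field_simp
    linarith
  have hsin : Real.sin (pol p) = cyl p / rad p := by
    rw [pol, Real.sin_arccos, sqrt_aux hp]
  have hcos : Real.cos (pol p) = p 2 / rad p := by
    have hab : |p 2 / rad p| ≤ 1 := by
      rw [abs_div, abs_of_pos hr, div_le_one hr]
      exact Real.abs_le_sqrt (by nlinarith [sq_nonneg (p 0), sq_nonneg (p 1)])
    rw [pol, Real.cos_arccos (abs_le.1 hab).1 (abs_le.1 hab).2]
  have r1 : deriv (fun s => s^2 * deriv (fun a => Ψ (a, pol p)) s) (rad p)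
      = 2 * rad p * P1 (rad p, pol p) + rad p ^ 2 * fderiv ℝ P1 (rad p, pol p) (1, 0) := by
    simp only [d1]
    refine ((hasDerivAt_pow 2 (rad p)).mul (line1 P1 hP1d (rad p) (pol p))).deriv.trans ?_
    simp
  have r2 : deriv (fun t => Real.sin t * deriv (fun a => Ψ (rad p, a)) t) (pol p)
      = p 2 / rad p * P2 (rad p, pol p)
        + cyl p / rad p * fderiv ℝ P2 (rad p, pol p) (0, 1) := by
    simp only [d2]
    refine ((Real.hasDerivAt_sin (pol p)).mul (line2 P2 hP2d (rad p) (pol p))).deriv.trans ?_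
    rw [hcos, hsin]
  have r3 : deriv (fun s => s * Ψ (s, pol p)) (rad p)
      = Ψ (rad p, pol p) + rad p * P1 (rad p, pol p) := by
    refine ((hasDerivAt_id (rad p)).mul (line1 Ψ hΨd (rad p) (pol p))).deriv.trans ?_
    rw [hP1]
    simp
  have hlhs : ∀ κ : ℝ, ∑ i, (-(ephi p i * K) + κ * (Ψ (rad p, pol p) • ephi p) i) * ephi p i
      = -K + κ * Ψ (rad p, pol p) := by
    intro κ
    have : -K + κ * Ψ (rad p, pol p)
        = (-K + κ * Ψ (rad p, pol p)) * ∑ i, ephi p i * ephi p i := by rw [hee, mul_one]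
    rw [this, Finset.mul_sum]
    refine Finset.sum_congr rfl fun i _ => ?_
    simp only [Pi.smul_apply, smul_eq_mul]
    ring
  simp only [hdiv, sphLap, r1, r2, r3, hsin]
  rw [hlhs, hK, hA]
  simp only []
  field_simp
  ring
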